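/- Let d ≥ 2 be an integer and let Φ be a Young function, differentiable on (0,∞) with derivative φ, with Φ(t) > 0 for t > 0, t·φ(t) ≥ Φ(t) for all t > 0, and Φ(t) → ∞ as t → ∞; let a > 0 be the (unique) point with Φ(a) = 1, and define Φ̂ : [0,∞) → [0,∞) by Φ̂(t) = t for 0 ≤ t < 1 and Φ̂(t) = 2·max{Φ(a·t), 2t − 1} − 1 for t ≥ 1. Then the function G(t) = (∫₀ᵗ (τ/Φ̂(τ))^{1/(d−1)} dτ)^{(d−1)/d} is finite for every t ≥ 0 and is increasing and concave on [0,∞), and its inverse function is convex. -/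

import Mathlib

open Set Filter MeasureTheory

/-- The primitive of an antitone function is concave. -/
theorem Antitone.concaveOn_integral {k : ℝ → ℝ} (hk : Antitone k) :
    ConcaveOn ℝ Set.univ (fun t => ∫ τ in (0 : ℝ)..t, k τ) := by
  have hint : ∀ x y : ℝ, IntervalIntegrable k volume x y := fun x y => hk.intervalIntegrable
  have hsub : ∀ x y : ℝ, (∫ τ in (0 : ℝ)..y, k τ) - ∫ τ in (0 : ℝ)..x, k τ = ∫ τ in x..y, k τ :=
    fun x y => intervalIntegral.integral_interval_sub_left (hint _ _) (hint _ _)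
  refine concaveOn_of_slope_anti_adjacent convex_univ fun {x y z} _ _ hxy hyz => ?_
  rw [hsub, hsub]
  have hupper : ∫ τ in y..z, k τ ≤ k y * (z - y) := by
    have h := intervalIntegral.integral_mono_on hyz.le (hint y z)
      (intervalIntegrable_const (c := k y)) fun τ hτ => hk hτ.1
    rw [intervalIntegral.integral_const, smul_eq_mul] at h
    linarith
  have hlower : k y * (y - x) ≤ ∫ τ in x..y, k τ := by
    have h := intervalIntegral.integral_mono_on hxy.le
      (intervalIntegrable_const (c := k y)) (hint x y) fun τ hτ => hk hτ.2
    rw [intervalIntegral.integral_const, smul_eq_mul] at h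
    linarith
  exact ((div_le_iff₀ (sub_pos.2 hyz)).2 hupper).trans ((le_div_iff₀ (sub_pos.2 hxy)).2 hlower)

/-- The inverse of a strictly increasing concave function is convex on its range, provided
this range is convex. -/
theorem ConcaveOn.convexOn_invFunOn {s : Set ℝ} {f : ℝ → ℝ} (hf : ConcaveOn ℝ s f)
    (hmono : StrictMonoOn f s) (himage : Convex ℝ (f '' s)) :
    ConvexOn ℝ (f '' s) (Function.invFunOn f s) := by
  refine ⟨himage, ?_⟩
  rintro _ ⟨x, hx, rfl⟩ _ ⟨y, hy, rfl⟩ p q hp hq hpq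
  have hinv : ∀ z ∈ s, Function.invFunOn f s (f z) = z := fun z hz =>
    hmono.injOn.leftInvOn_invFunOn hz
  obtain ⟨z, hz, hfz⟩ := himage ⟨x, hx, rfl⟩ ⟨y, hy, rfl⟩ hp hq hpq
  rw [← hfz, hinv x hx, hinv y hy, hinv z hz]
  refine (hmono.le_iff_le hz (hf.1 hx hy hp hq hpq)).1 ?_
  rw [hfz]
  exact hf.2 hx hy hp hq hpq

/-- Let `d ≥ 2` and let `Φ` be a Young function with derivative `φ`,
`Φ(t) > 0` for `t > 0`, `t φ(t) ≥ Φ(t)`, and `Φ(t) → ∞` as `t → ∞`; let `a > 0` satisfy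
`Φ(a) = 1` and define `Φ̂(t) = t` for `0 ≤ t < 1`, `Φ̂(t) = 2 max (Φ(a t)) (2t − 1) − 1`
for `t ≥ 1`. Then `G(t) = (∫₀ᵗ (τ/Φ̂(τ))^{1/(d−1)} dτ)^{(d−1)/d}` is finite for every
`t ≥ 0` (i.e. the integrand is integrable on `(0,t]`), `G` is increasing and concave on
`[0,∞)`, and its inverse function is convex. -/
theorem stmt19
    (d : ℕ) (hd : 2 ≤ d)
    (Φ φ Φhat : ℝ → ℝ) (a : ℝ)
    -- Φ is a Young function
    (hconv : ConvexOn ℝ (Set.Ici (0 : ℝ)) Φ)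
    (hcont : ContinuousOn Φ (Set.Ici (0 : ℝ)))
    (hΦ0 : Φ 0 = 0)
    (hnonneg : ∀ t : ℝ, 0 ≤ t → 0 ≤ Φ t)
    (hnonconst : ∃ t : ℝ, 0 ≤ t ∧ Φ t ≠ 0)
    -- Φ is differentiable on (0,∞) with derivative φ, positive, t φ(t) ≥ Φ(t), Φ → ∞
    (hderiv : ∀ t : ℝ, 0 < t → HasDerivAt Φ (φ t) t)
    (hpos : ∀ t : ℝ, 0 < t → 0 < Φ t)
    (hineq : ∀ t : ℝ, 0 < t → Φ t ≤ t * φ t)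
    (hinf : Tendsto Φ atTop atTop)
    -- a is the unique point with Φ(a) = 1
    (ha : 0 < a) (hΦa : Φ a = 1)
    (hauniq : ∀ t : ℝ, 0 < t → Φ t = 1 → t = a)
    -- the definition of Φ̂
    (hΦhat1 : ∀ t : ℝ, 0 ≤ t → t < 1 → Φhat t = t)
    (hΦhat2 : ∀ t : ℝ, 1 ≤ t → Φhat t = 2 * max (Φ (a * t)) (2 * t - 1) - 1)
    -- the function G
    (G : ℝ → ℝ)
    (hG : ∀ t : ℝ, G t =
      (∫ τ in Set.Ioc (0 : ℝ) t, (τ / Φhat τ) ^ ((1 : ℝ) / ((d : ℝ) - 1))) ^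
        (((d : ℝ) - 1) / (d : ℝ))) :
    (∀ t : ℝ, 0 ≤ t →
        IntegrableOn (fun τ => (τ / Φhat τ) ^ ((1 : ℝ) / ((d : ℝ) - 1))) (Set.Ioc 0 t)) ∧
      StrictMonoOn G (Set.Ici (0 : ℝ)) ∧
      ConcaveOn ℝ (Set.Ici (0 : ℝ)) G ∧
      ConvexOn ℝ (G '' Set.Ici (0 : ℝ)) (Function.invFunOn G (Set.Ici (0 : ℝ))) := by
  have hd1 : (0 : ℝ) < (d : ℝ) - 1 := by
    have : (2 : ℝ) ≤ d := by exact_mod_cast hd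
    linarith
  have hd0 : (0 : ℝ) < d := by linarith
  have hhat_ge : ∀ t : ℝ, 1 ≤ t → t ≤ Φhat t := fun t ht => by
    rw [hΦhat2 t ht]
    linarith [le_max_right (Φ (a * t)) (2 * t - 1)]
  have hhat_pos : ∀ t : ℝ, 0 < t → 0 < Φhat t := fun t ht => by
    rcases lt_or_ge t 1 with h | h
    · rwa [hΦhat1 t ht.le h]
    · linarith [hhat_ge t h]
  have hstar : ∀ s t : ℝ, 0 < s → s ≤ t → t * Φ (a * s) ≤ s * Φ (a * t) := fun s t hs hst => by
    have ht : 0 < t := hs.trans_le hst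
    have hle : 0 ≤ 1 - s / t := by
      rw [sub_nonneg, div_le_one ht]
      exact hst
    have h := hconv.2 (Set.mem_Ici.2 le_rfl) (Set.mem_Ici.2 (mul_pos ha ht).le) hle
      (div_pos hs ht).le (sub_add_cancel 1 (s / t))
    have he : (1 - s / t) • (0 : ℝ) + (s / t) • (a * t) = a * s := by
      simp only [smul_eq_mul]
      field_simp
      ring
    rw [he, hΦ0, smul_zero, zero_add, smul_eq_mul] at h
    calc t * Φ (a * s) ≤ t * (s / t * Φ (a * t)) := by gcongr
      _ = s * Φ (a * t) := by field_simp
  have hratio : ∀ s t : ℝ, 0 < s → s ≤ t → t / Φhat t ≤ s / Φhat s := fun s t hs hst => by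
    have ht : 0 < t := hs.trans_le hst
    rw [div_le_div_iff₀ (hhat_pos t ht) (hhat_pos s hs)]
    rcases lt_or_ge s 1 with h | h
    · rw [hΦhat1 s hs.le h, mul_comm]
      refine mul_le_mul_of_nonneg_left ?_ hs.le
      rcases lt_or_ge t 1 with h' | h'
      · rw [hΦhat1 t ht.le h']
      · exact hhat_ge t h'
    · rw [hΦhat2 s h, hΦhat2 t (h.trans hst)]
      have hmax : t * max (Φ (a * s)) (2 * s - 1) ≤ s * max (Φ (a * t)) (2 * t - 1) := by
        rw [mul_max_of_nonneg _ _ ht.le, mul_max_of_nonneg _ _ hs.le]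
        exact max_le_max (hstar s t hs hst) (by nlinarith)
      nlinarith
  -- A globally antitone function agreeing with the integrand on `(0, ∞)`.
  set g : ℝ → ℝ := fun τ => (τ / Φhat τ) ^ ((1 : ℝ) / ((d : ℝ) - 1)) with hg
  set k : ℝ → ℝ := fun τ => g (max τ (1 / 2)) with hk_def
  have hmax_pos : ∀ τ : ℝ, 0 < max τ (1 / 2) := fun τ => lt_max_of_lt_right (by norm_num)
  have hk : Antitone k := fun s t hst =>
    Real.rpow_le_rpow (div_pos (hmax_pos t) (hhat_pos _ (hmax_pos t))).le
      (hratio _ _ (hmax_pos s) (max_le_max_right _ hst)) (by positivity)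
  have hk_pos : ∀ τ, 0 < k τ := fun τ =>
    Real.rpow_pos_of_pos (div_pos (hmax_pos τ) (hhat_pos _ (hmax_pos τ))) _
  have hgk : ∀ τ : ℝ, 0 < τ → g τ = k τ := fun τ hτ => by
    rcases le_total (1 / 2) τ with h | h
    · simp only [hk_def, max_eq_left h]
    · simp only [hk_def, hg, max_eq_right h]
      rw [hΦhat1 τ hτ.le (by linarith), hΦhat1 (1 / 2) (by norm_num) (by norm_num),
        div_self hτ.ne', div_self (by norm_num)]
  have hint : ∀ x y : ℝ, IntervalIntegrable k volume x y := fun x y => hk.intervalIntegrable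
  set H : ℝ → ℝ := fun t => ∫ τ in (0 : ℝ)..t, k τ with hH
  have hH_cont : Continuous H := intervalIntegral.continuous_primitive hint 0
  have hH_mono : StrictMono H := fun x y hxy => by
    rw [← sub_pos, hH]
    simp only
    rw [intervalIntegral.integral_interval_sub_left (hint _ _) (hint _ _)]
    exact intervalIntegral.intervalIntegral_pos_of_pos (hint _ _) hk_pos hxy
  have hH_zero : H 0 = 0 := intervalIntegral.integral_same
  have hH_nonneg : ∀ t : ℝ, 0 ≤ t → 0 ≤ H t := fun t ht => hH_zero ▸ hH_mono.monotone ht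
  have hGH : ∀ t : ℝ, 0 ≤ t → G t = H t ^ (((d : ℝ) - 1) / (d : ℝ)) := fun t ht => by
    rw [hG t, hH]
    simp only
    rw [intervalIntegral.integral_of_le ht]
    congr 1
    exact setIntegral_congr_fun measurableSet_Ioc fun τ hτ => hgk τ hτ.1
  have he_pos : 0 < ((d : ℝ) - 1) / (d : ℝ) := by positivity
  have he_le : ((d : ℝ) - 1) / (d : ℝ) ≤ 1 := by
    rw [div_le_one hd0]
    linarith
  have hmono : StrictMonoOn G (Set.Ici (0 : ℝ)) := fun x hx y hy hxy => by
    rw [hGH x hx, hGH y hy]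
    exact Real.rpow_lt_rpow (hH_nonneg x hx) (hH_mono hxy) he_pos
  have hconc : ConcaveOn ℝ (Set.Ici (0 : ℝ)) G := by
    refine ⟨convex_Ici 0, fun x hx y hy p q hp hq hpq => ?_⟩
    have hz : p • x + q • y ∈ Set.Ici (0 : ℝ) := convex_Ici 0 hx hy hp hq hpq
    rw [hGH x hx, hGH y hy, hGH _ hz]
    refine ((Real.concaveOn_rpow he_pos.le he_le).2 (hH_nonneg x hx) (hH_nonneg y hy)
      hp hq hpq).trans (Real.rpow_le_rpow ?_ ?_ he_pos.le)
    · exact convex_Ici (0 : ℝ) (hH_nonneg x hx) (hH_nonneg y hy) hp hq hpq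
    · exact hk.concaveOn_integral.2 (Set.mem_univ x) (Set.mem_univ y) hp hq hpq
  have hG_cont : ContinuousOn G (Set.Ici (0 : ℝ)) :=
    (hH_cont.rpow_const fun _ => Or.inr he_pos.le).continuousOn.congr hGH
  refine ⟨fun t ht => ?_, hmono, hconc, hconc.convexOn_invFunOn hmono ?_⟩
  · exact ((intervalIntegrable_iff_integrableOn_Ioc_of_le ht).1 (hint 0 t)).congr_fun
      (fun τ hτ => (hgk τ hτ.1).symm) measurableSet_Ioc
  · exact (isPreconnected_Ici.image G hG_cont).ordConnected.convex
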